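/- Conformal quantile coverage: let V_1, …, V_{n+1} be exchangeable real-valued random variables and let δ ∈ (0,1) with m := ⌈(1−δ)(n+1)⌉ ≤ n. Then ℙ(V_{n+1} ≤ V_{(m)}) ≥ 1 − δ, where V_{(m)} denotes the m-th smallest value among V_1, …, V_n. -/

import Mathlib

open MeasureTheory

/-- In a sorted list, if the entry at position `k` is below `x`, then more than `k` entries are. -/
lemma List.lt_countP_lt_of_getElem_lt {l : List ℝ} (hl : l.Pairwise (· ≤ ·)) {k : ℕ}
    (hk : k < l.length) {x : ℝ} (hx : l[k] < x) : k < l.countP (fun y => decide (y < x)) := by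
  have htake : (l.take (k + 1)).countP (fun y => decide (y < x)) = (l.take (k + 1)).length := by
    rw [List.countP_eq_length]
    intro y hy
    obtain ⟨i, hi, rfl⟩ := List.mem_iff_getElem.1 hy
    have hik : i ≤ k := by simp at hi; omega
    have hle : l[i] ≤ l[k] := by
      rcases hik.eq_or_lt with rfl | hlt
      · exact le_rfl
      · exact List.pairwise_iff_getElem.1 hl i k _ hk hlt
    simpa using hle.trans_lt hx
  have hsub := (List.take_sublist (k + 1) l).countP_le (p := fun y => decide (y < x))
  rw [htake, List.length_take] at hsub
  omega

/-- A value with fewer than `m` strictly smaller entries in a tuple is at most the `m`-th smallest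
entry. -/
lemma le_sort_getD_of_card_lt {n m : ℕ} (hm : 0 < m) (hmn : m ≤ n) (f : Fin n → ℝ) {x : ℝ}
    (h : (Finset.univ.filter fun i => f i < x).card < m) :
    x ≤ ((Multiset.ofList (List.ofFn f)).sort (· ≤ ·)).getD (m - 1) 0 := by
  set s := (Multiset.ofList (List.ofFn f)).sort (· ≤ ·) with hs
  have hlen : s.length = n := by simp [hs]
  have hk : m - 1 < s.length := by omega
  rw [List.getD_eq_getElem _ _ hk]
  by_contra! hx
  have hlt : m - 1 < s.countP (fun y => decide (y < x)) :=
    List.lt_countP_lt_of_getElem_lt (Multiset.pairwise_sort _ (· ≤ ·)) hk hx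
  have hcount : s.countP (fun y => decide (y < x))
      = (Finset.univ.filter fun i => f i < x).card := by
    rw [← Multiset.coe_countP, hs, Multiset.sort_eq, ← Fin.univ_val_map, Multiset.countP_map]
    rfl
  omega

/-- At least `m` entries of a tuple have fewer than `m` entries strictly below them. -/
lemma le_card_filter_card_lt {N m : ℕ} (hm : m ≤ N) (v : Fin N → ℝ) :
    m ≤ (Finset.univ.filter fun j => (Finset.univ.filter fun i => v i < v j).card < m).card := by
  have hsmall : (Finset.univ.filter fun k : Fin N => (k : ℕ) < m).card = m := by
    rw [Fin.card_filter_val_lt, min_eq_right hm]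
  refine (hsmall.symm.trans (Finset.card_map (Tuple.sort v).toEmbedding).symm).trans_le ?_
  refine Finset.card_le_card fun j hj => ?_
  obtain ⟨k, hk, rfl⟩ := Finset.mem_map.1 hj
  simp only [Finset.mem_filter, Finset.mem_univ, true_and, Equiv.coe_toEmbedding] at hk ⊢
  refine lt_of_le_of_lt ?_ hk
  refine le_of_le_of_eq (Finset.card_le_card fun i hi => ?_)
    ((Finset.card_map (Tuple.sort v).toEmbedding).trans (Fin.card_Iio k))
  refine Finset.mem_map.2 ⟨(Tuple.sort v).symm i, ?_, (Tuple.sort v).apply_symm_apply i⟩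
  rw [Finset.mem_Iio]
  by_contra! hle
  have hmono := Tuple.monotone_sort v hle
  simp only [Function.comp_apply, Equiv.apply_symm_apply] at hmono
  exact absurd (Finset.mem_filter.1 hi).2 hmono.not_gt

lemma measurableSet_card_lt {ι : Type*} [Fintype ι] (j : ι) (m : ℕ) :
    MeasurableSet {v : ι → ℝ | (Finset.univ.filter fun i => v i < v j).card < m} := by
  simp only [Finset.card_filter]
  refine measurableSet_lt (Finset.measurable_fun_sum _ fun i _ => ?_) measurable_const
  exact Measurable.ite (measurableSet_lt (measurable_pi_apply i) (measurable_pi_apply j))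
    measurable_const measurable_const

/-- If every point lies in at least `m` of finitely many events, their probabilities add up to at
least `m`. -/
lemma natCast_le_sum_measure {Ω ι : Type*} [MeasurableSpace Ω] [Fintype ι] (μ : Measure Ω)
    [IsProbabilityMeasure μ] {A : ι → Set Ω} (hA : ∀ j, MeasurableSet (A j)) {m : ℕ}
    [∀ ω, DecidablePred fun j => ω ∈ A j]
    (h : ∀ ω, m ≤ (Finset.univ.filter fun j => ω ∈ A j).card) :
    (m : ENNReal) ≤ ∑ j, μ (A j) := by
  calc (m : ENNReal) = ∫⁻ _, (m : ENNReal) ∂μ := by simp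
    _ ≤ ∫⁻ ω, ∑ j, (A j).indicator 1 ω ∂μ := by
        refine lintegral_mono fun ω => ?_
        have hcard : ∑ j, (A j).indicator (1 : Ω → ENNReal) ω
            = ((Finset.univ.filter fun j => ω ∈ A j).card : ENNReal) := by
          rw [Finset.card_filter]
          push_cast
          exact Finset.sum_congr rfl fun j _ => by by_cases hj : ω ∈ A j <;> simp [hj]
        rw [hcard]
        exact Nat.cast_le.2 (h ω)
    _ = ∑ j, μ (A j) := by
        rw [lintegral_finsetSum _ fun j _ => measurable_one.indicator (hA j)]
        simp [hA]

/-- Under exchangeability, all coordinates are equally likely to have fewer than `m` coordinates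
strictly below them. -/
lemma measure_card_lt_eq_of_exchangeable {Ω ι : Type*} [MeasurableSpace Ω] [Fintype ι]
    [DecidableEq ι] {μ : Measure Ω} {V : ι → Ω → ℝ} (hV : ∀ i, Measurable (V i))
    (hexch : ∀ σ : Equiv.Perm ι,
      Measure.map (fun ω => fun i => V (σ i) ω) μ = Measure.map (fun ω => fun i => V i ω) μ)
    (m : ℕ) (j k : ι) :
    μ {ω | (Finset.univ.filter fun i => V i ω < V j ω).card < m}
      = μ {ω | (Finset.univ.filter fun i => V i ω < V k ω).card < m} := by
  have hmap := congrArg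
    (fun ν => ν {v : ι → ℝ | (Finset.univ.filter fun i => v i < v k).card < m})
    (hexch (Equiv.swap j k))
  rw [Measure.map_apply (measurable_pi_lambda _ fun i => hV _) (measurableSet_card_lt k m),
    Measure.map_apply (measurable_pi_lambda _ hV) (measurableSet_card_lt k m)] at hmap
  rw [Set.preimage_ofPred_eq, Set.preimage_ofPred_eq] at hmap
  rw [← hmap]
  congr 1
  ext ω
  have hcard : (Finset.univ.filter fun i => V (Equiv.swap j k i) ω < V j ω).card
      = (Finset.univ.filter fun i => V i ω < V j ω).card :=
    Finset.card_equiv (Equiv.swap j k) fun i => by simp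
  simp only [Set.mem_ofPred_eq, Equiv.swap_apply_right, hcard]

open Classical in
/-- conformal quantile coverage. If `V_1, …, V_{n+1}` are exchangeable
real random variables, `δ ∈ (0,1)` and `m = ⌈(1−δ)(n+1)⌉ ≤ n`, then
`ℙ(V_{n+1} ≤ V_(m)) ≥ 1 − δ`, where `V_(m)` is the `m`-th smallest of `V_1, …, V_n`. -/
theorem conformal_quantile_coverage {Ω : Type*} [MeasurableSpace Ω]
    (μ : Measure Ω) [IsProbabilityMeasure μ] {n : ℕ}
    (V : Fin (n + 1) → Ω → ℝ) (hV : ∀ i, Measurable (V i))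
    (hexch : ∀ σ : Equiv.Perm (Fin (n + 1)),
      Measure.map (fun ω => fun i => V (σ i) ω) μ
        = Measure.map (fun ω => fun i => V i ω) μ)
    (δ : ℝ) (hδ : δ ∈ Set.Ioo (0 : ℝ) 1)
    (m : ℕ) (hm : m = ⌈(1 - δ) * (n + 1)⌉₊) (hmn : m ≤ n) :
    ENNReal.ofReal (1 - δ)
      ≤ μ {ω | V (Fin.last n) ω ≤
            ((Multiset.ofList (List.ofFn fun i : Fin n => V i.castSucc ω)).sort
              (· ≤ ·)).getD (m - 1) 0} := by
  have hpos : 0 < (1 - δ) * ((n : ℝ) + 1) := mul_pos (by linarith [hδ.2]) (by positivity)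
  have hm0 : 0 < m := hm ▸ Nat.ceil_pos.2 hpos
  have hceil : (1 - δ) * ((n : ℝ) + 1) ≤ m := hm ▸ Nat.le_ceil _
  set A : Fin (n + 1) → Set Ω :=
    fun j => {ω | (Finset.univ.filter fun i => V i ω < V j ω).card < m} with hA
  have hAmeas : ∀ j, MeasurableSet (A j) := fun j =>
    measurable_pi_lambda (fun ω i => V i ω) hV (measurableSet_card_lt j m)
  have hsum : (m : ENNReal) ≤ ∑ j, μ (A j) := by
    refine natCast_le_sum_measure μ hAmeas fun ω => ?_
    convert le_card_filter_card_lt (hmn.trans n.le_succ) fun i => V i ω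
    exact Iff.rfl
  have hconst : ∀ j, μ (A j) = μ (A (Fin.last n)) := fun j =>
    measure_card_lt_eq_of_exchangeable hV hexch m j (Fin.last n)
  have hlast : ENNReal.ofReal (1 - δ) ≤ μ (A (Fin.last n)) := by
    simp only [hconst, Finset.sum_const, Finset.card_univ, Fintype.card_fin, nsmul_eq_mul] at hsum
    rw [ENNReal.ofReal_le_iff_le_toReal (measure_ne_top _ _)]
    have hreal := ENNReal.toReal_mono
      (ENNReal.mul_ne_top (ENNReal.natCast_ne_top _) (measure_ne_top _ _)) hsum
    rw [ENNReal.toReal_mul, ENNReal.toReal_natCast, ENNReal.toReal_natCast] at hreal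
    push_cast at hreal
    refine le_of_mul_le_mul_right (hceil.trans (hreal.trans_eq (mul_comm _ _))) (by positivity)
  refine hlast.trans (measure_mono fun ω hω => ?_)
  refine le_sort_getD_of_card_lt hm0 hmn (fun i : Fin n => V i.castSucc ω) ?_
  refine lt_of_le_of_lt ?_ (show (Finset.univ.filter fun i => V i ω < V (Fin.last n) ω).card < m
    from hω)
  exact Finset.card_le_card_of_injOn Fin.castSucc (fun i hi => by simpa using hi)
    (Fin.castSucc_injective n).injOn
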